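/- Let p be a prime, G a finite group, A a subgroup of the center Z(G) whose order is not divisible by p, and H = G/A with canonical projection π : G → H. Then the assignment E ↦ π(E) induces a bijection between the set of G-conjugacy classes of maximal elementary abelian p-subgroups of order p² of G and the set of H-conjugacy classes of maximal elementary abelian p-subgroups of order p² of H; moreover the p-rank of G equals the p-rank of H. -/

import Mathlib

/-- `E` is an elementary abelian `p`-subgroup of `G`: every element of `E` satisfies
`x ^ p = 1` and any two elements of `E` commute. -/
def IsElementaryAbelian (p : ℕ) {G : Type*} [Group G] (E : Subgroup G) : Prop :=
  (∀ x ∈ E, x ^ p = 1) ∧ ∀ x ∈ E, ∀ y ∈ E, x * y = y * x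

/-- `E` is a maximal elementary abelian `p`-subgroup of `G`. -/
def IsMaximalElementaryAbelian (p : ℕ) {G : Type*} [Group G] (E : Subgroup G) : Prop :=
  IsElementaryAbelian p E ∧
    ∀ F : Subgroup G, IsElementaryAbelian p F → E ≤ F → E = F

/-- Two subgroups of `G` are conjugate in `G`. -/
def IsConjSubgroup {G : Type*} [Group G] (E F : Subgroup G) : Prop :=
  ∃ g : G, E.map (MulAut.conj g).toMonoidHom = F

/-- The `p`-rank of `G`: the largest `r` such that `G` has an elementary abelian
`p`-subgroup of order `p ^ r`. -/
noncomputable def pRank (p : ℕ) (G : Type*) [Group G] : ℕ :=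
  sSup {r : ℕ | ∃ E : Subgroup G, IsElementaryAbelian p E ∧ Nat.card E = p ^ r}

/-- The homomorphism `π` restricts to a bijection between the solutions of `x ^ p = 1` in `G`
and in `H`. -/
structure BijectiveOnTorsion (p : ℕ) {G H : Type*} [Group G] [Group H] (π : G →* H) : Prop where
  inj : ∀ x y : G, x ^ p = 1 → y ^ p = 1 → π x = π y → x = y
  surj : ∀ h : H, h ^ p = 1 → ∃ x : G, x ^ p = 1 ∧ π x = h

/-- A surjection with finite central kernel of order prime to `p` is bijective on elements of
exponent `p`. -/
theorem bijectiveOnTorsion_of_ker_le_center {p : ℕ} [hp : Fact p.Prime] {G H : Type*} [Group G]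
    [Group H] (π : G →* H) (hsurj : Function.Surjective π)
    (hcen : π.ker ≤ Subgroup.center G) (hcard : ¬ p ∣ Nat.card π.ker) :
    BijectiveOnTorsion p π where
  inj x y hx hy hxy := by
    have hmem : x⁻¹ * y ∈ π.ker := by simp [MonoidHom.mem_ker, hxy]
    have hcomm : Commute x (x⁻¹ * y) := (Subgroup.mem_center_iff.1 (hcen hmem) x)
    have hpow : (x⁻¹ * y) ^ p = 1 := by
      have h := hcomm.mul_pow p
      rw [mul_inv_cancel_left, hx, hy, one_mul] at h
      exact h.symm
    have hord : (x⁻¹ * y) ^ Nat.card π.ker = 1 := by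
      have h := pow_card_eq_one' (x := (⟨x⁻¹ * y, hmem⟩ : π.ker))
      simpa using congrArg Subtype.val h
    have hcop : Nat.Coprime p (Nat.card π.ker) := (hp.out.coprime_iff_not_dvd).2 hcard
    have h1 : x⁻¹ * y = 1 := by
      simpa only [hcop.gcd_eq_one, pow_one] using pow_gcd_eq_one.2 ⟨hpow, hord⟩
    exact (inv_mul_eq_one.1 h1)
  surj h hh := by
    obtain ⟨x, rfl⟩ := hsurj h
    have hcop : (Nat.card π.ker).Coprime p := ((hp.out.coprime_iff_not_dvd).2 hcard).symm
    obtain ⟨m, -, hm⟩ := Nat.exists_mul_mod_eq_one_of_coprime hcop hp.out.one_lt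
    refine ⟨x ^ (Nat.card π.ker * m), ?_, ?_⟩
    · have hmem : x ^ p ∈ π.ker := by rw [MonoidHom.mem_ker, map_pow, hh]
      have hord : (x ^ p) ^ Nat.card π.ker = 1 := by
        have h := pow_card_eq_one' (x := (⟨x ^ p, hmem⟩ : π.ker))
        simpa using congrArg Subtype.val h
      rw [← pow_mul, mul_comm, pow_mul, pow_mul, hord, one_pow]
    · rw [map_pow, pow_eq_pow_mod _ hh, hm, pow_one]

theorem IsElementaryAbelian.map {p : ℕ} {G H : Type*} [Group G] [Group H] {E : Subgroup G}
    (hE : IsElementaryAbelian p E) (π : G →* H) : IsElementaryAbelian p (E.map π) := by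
  constructor
  · rintro _ ⟨x, hx, rfl⟩
    rw [← map_pow, hE.1 x hx, map_one]
  · rintro _ ⟨x, hx, rfl⟩ _ ⟨y, hy, rfl⟩
    rw [← map_mul, hE.2 x hx y hy, map_mul]

namespace BijectiveOnTorsion

variable {p : ℕ} {G H : Type*} [Group G] [Group H] {π : G →* H}

theorem commute_of_map (hπ : BijectiveOnTorsion p π) {x y : G} (hy : y ^ p = 1)
    (h : π x * π y = π y * π x) : x * y = y * x := by
  have h1 : x * y * x⁻¹ = y := by
    refine hπ.inj _ _ ?_ hy ?_
    · rw [conj_pow, hy, mul_one, mul_inv_cancel]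
    · rw [map_mul, map_mul, h, map_inv, mul_inv_cancel_right]
  exact mul_inv_eq_iff_eq_mul.1 h1

theorem le_of_map_le (hπ : BijectiveOnTorsion p π) {E F : Subgroup G}
    (hE : IsElementaryAbelian p E) (hF : IsElementaryAbelian p F) (h : E.map π ≤ F.map π) :
    E ≤ F := by
  intro x hx
  obtain ⟨y, hy, hxy⟩ := h (Subgroup.mem_map_of_mem π hx)
  rwa [← hπ.inj y x (hF.1 y hy) (hE.1 x hx) hxy]

theorem eq_of_map_eq (hπ : BijectiveOnTorsion p π) {E F : Subgroup G}
    (hE : IsElementaryAbelian p E) (hF : IsElementaryAbelian p F) (h : E.map π = F.map π) :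
    E = F :=
  le_antisymm (hπ.le_of_map_le hE hF h.le) (hπ.le_of_map_le hF hE h.ge)

theorem card_map (hπ : BijectiveOnTorsion p π) {E : Subgroup G}
    (hE : IsElementaryAbelian p E) : Nat.card (E.map π) = Nat.card E :=
  Nat.card_image_of_injOn fun x hx y hy h => hπ.inj x y (hE.1 x hx) (hE.1 y hy) h

theorem exists_map_eq (hπ : BijectiveOnTorsion p π) {F : Subgroup H}
    (hF : IsElementaryAbelian p F) :
    ∃ E : Subgroup G, IsElementaryAbelian p E ∧ E.map π = F := by
  have hcomm : ∀ x y : G, π x ∈ F → y ^ p = 1 → π y ∈ F → x * y = y * x :=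
    fun x y hx hy hy' => hπ.commute_of_map hy (hF.2 _ hx _ hy')
  let E : Subgroup G :=
    { carrier := {x | x ^ p = 1 ∧ π x ∈ F}
      one_mem' := ⟨one_pow p, by simp⟩
      mul_mem' := by
        rintro x y ⟨hx, hx'⟩ ⟨hy, hy'⟩
        refine ⟨?_, by simpa using F.mul_mem hx' hy'⟩
        rw [Commute.mul_pow (hcomm x y hx' hy hy'), hx, hy, one_mul]
      inv_mem' := by
        rintro x ⟨hx, hx'⟩
        exact ⟨by rw [inv_pow, hx, inv_one], by simpa using hx'⟩ }
  refine ⟨E, ⟨fun x hx => hx.1, fun x hx y hy => hcomm x y hx.2 hy.1 hy.2⟩, ?_⟩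
  ext h
  constructor
  · rintro ⟨x, hx, rfl⟩
    exact hx.2
  · intro hh
    obtain ⟨x, hx, rfl⟩ := hπ.surj h (hF.1 h hh)
    exact ⟨x, ⟨hx, hh⟩, rfl⟩

theorem isMaximalElementaryAbelian_map_iff (hπ : BijectiveOnTorsion p π) {E : Subgroup G}
    (hE : IsElementaryAbelian p E) :
    IsMaximalElementaryAbelian p (E.map π) ↔ IsMaximalElementaryAbelian p E := by
  constructor
  · rintro ⟨-, hmax⟩
    exact ⟨hE, fun F hF hEF =>
      hπ.eq_of_map_eq hE hF (hmax _ (hF.map π) (Subgroup.map_mono hEF))⟩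
  · rintro ⟨-, hmax⟩
    refine ⟨hE.map π, fun F hF hEF => ?_⟩
    obtain ⟨E', hE', rfl⟩ := hπ.exists_map_eq hF
    rw [hmax E' hE' (hπ.le_of_map_le hE hE' hEF)]

theorem pRank_eq (hπ : BijectiveOnTorsion p π) : pRank p G = pRank p H := by
  unfold pRank
  congr 1
  ext r
  constructor
  · rintro ⟨E, hE, hr⟩
    exact ⟨E.map π, hE.map π, (hπ.card_map hE).trans hr⟩
  · rintro ⟨F, hF, hr⟩
    obtain ⟨E, hE, rfl⟩ := hπ.exists_map_eq hF
    exact ⟨E, hE, (hπ.card_map hE).symm.trans hr⟩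

end BijectiveOnTorsion

theorem map_map_conj {G H : Type*} [Group G] [Group H] (π : G →* H) (g : G) (E : Subgroup G) :
    (E.map (MulAut.conj g).toMonoidHom).map π =
      (E.map π).map (MulAut.conj (π g)).toMonoidHom := by
  rw [Subgroup.map_map, Subgroup.map_map]
  congr 1
  ext x
  simp

theorem isConjSubgroup_refl {G : Type*} [Group G] (E : Subgroup G) : IsConjSubgroup E E :=
  ⟨1, by ext; simp⟩

theorem BijectiveOnTorsion.isConjSubgroup_map_iff {p : ℕ} {G H : Type*} [Group G] [Group H]
    {π : G →* H} (hπ : BijectiveOnTorsion p π) (hsurj : Function.Surjective π)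
    {E E' : Subgroup G} (hE : IsElementaryAbelian p E) (hE' : IsElementaryAbelian p E') :
    IsConjSubgroup (E.map π) (E'.map π) ↔ IsConjSubgroup E E' := by
  constructor
  · rintro ⟨h, hh⟩
    obtain ⟨g, rfl⟩ := hsurj h
    rw [← map_map_conj] at hh
    exact ⟨g, hπ.eq_of_map_eq (hE.map _) hE' hh⟩
  · rintro ⟨g, rfl⟩
    exact ⟨π g, (map_map_conj π g E).symm⟩


/-- Let `p` be a prime, `G` a finite group, `A ≤ Z(G)` with `p ∤ |A|`, and
`1 → A → G → H → 1` a central extension (so `H ≅ G/A` with canonical projection `π`).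
Then `E ↦ π(E)` induces a bijection between the `G`-conjugacy classes of maximal
elementary abelian `p`-subgroups of order `p²` of `G` and the `H`-conjugacy classes of
maximal elementary abelian `p`-subgroups of order `p²` of `H`; moreover the `p`-rank of
`G` equals the `p`-rank of `H`. -/
theorem central_pprime_quotient_bijection_maximal_elemAb_classes
    (p : ℕ) [Fact p.Prime] (G : Type*) [Group G] [Finite G]
    (A : Subgroup G) (hA : A ≤ Subgroup.center G) (hAp : ¬ p ∣ Nat.card A)
    (H : Type*) [Group H] (π : G →* H) (hsurj : Function.Surjective π) (hker : π.ker = A) :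
    (∀ E : Subgroup G, IsMaximalElementaryAbelian p E → Nat.card E = p ^ 2 →
      IsMaximalElementaryAbelian p (E.map π) ∧ Nat.card (E.map π) = p ^ 2) ∧
    (∀ F : Subgroup H, IsMaximalElementaryAbelian p F → Nat.card F = p ^ 2 →
      ∃ E : Subgroup G, IsMaximalElementaryAbelian p E ∧ Nat.card E = p ^ 2 ∧
        IsConjSubgroup (E.map π) F) ∧
    (∀ E E' : Subgroup G,
      IsMaximalElementaryAbelian p E → Nat.card E = p ^ 2 →
      IsMaximalElementaryAbelian p E' → Nat.card E' = p ^ 2 →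
      (IsConjSubgroup E E' ↔ IsConjSubgroup (E.map π) (E'.map π))) ∧
    pRank p G = pRank p H := by
  subst hker
  have hπ := bijectiveOnTorsion_of_ker_le_center π hsurj hA hAp
  refine ⟨fun E hE hc => ⟨(hπ.isMaximalElementaryAbelian_map_iff hE.1).2 hE,
    (hπ.card_map hE.1).trans hc⟩, fun F hF hc => ?_,
    fun E E' hE _ hE' _ => (hπ.isConjSubgroup_map_iff hsurj hE.1 hE'.1).symm, hπ.pRank_eq⟩
  obtain ⟨E, hE, rfl⟩ := hπ.exists_map_eq hF.1
  exact ⟨E, (hπ.isMaximalElementaryAbelian_map_iff hE).1 hF, (hπ.card_map hE).symm.trans hc,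
    isConjSubgroup_refl _⟩
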